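/- arXiv:1504.04465 — 6 statements merged into one kernel-verified Lean document; each statement's English description precedes it below -/
import Mathlib

section
/- Let G be a bipartite graph with variable nodes V and check nodes C, let D ⊆ C be a set of check nodes, and let G∖D denote the bipartite graph with variable nodes V, check nodes C∖D, and adjacency inherited from G. Suppose S ⊆ V is a stopping set of G∖D, T ⊆ V is a stopping set of G, and every check node in D is adjacent (in G) to at least one element of T. Then S ∪ T is a stopping set of G. (This is the key combinatorial step in the proof of Theorem 1: a stopping set surviving in the receiver's reconstructed graph, together with the stopping set of unresolved users whose slots were removed, forms a stopping set of the full graph.) -/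
/-- A stopping set of a bipartite graph with variable nodes `V`, check nodes `C`, and
adjacency relation `Adj`: every variable node in `S` is adjacent to at least one check
node, and every check node adjacent to at least one element of `S` is adjacent to at
least two elements of `S`. -/
def IsStoppingSet {V C : Type*} (Adj : V → C → Prop) (S : Set V) : Prop :=
  (∀ v ∈ S, ∃ c : C, Adj v c) ∧
  ∀ c : C, (∃ v ∈ S, Adj v c) → ∃ v ∈ S, ∃ w ∈ S, v ≠ w ∧ Adj v c ∧ Adj w c

/-- If `S` is a stopping set of `G ∖ D` (the graph with check nodes in `D` deleted),
`T` is a stopping set of `G`, and every check node of `D` is adjacent to some element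
of `T`, then `S ∪ T` is a stopping set of `G`. -/
theorem union_stoppingSet_of_deleted {V C : Type*} [Fintype V] [Fintype C]
    (Adj : V → C → Prop) (D : Set C) (S T : Set V)
    (hS : IsStoppingSet (fun v c => Adj v c ∧ c ∉ D) S)
    (hT : IsStoppingSet Adj T)
    (hD : ∀ c ∈ D, ∃ v ∈ T, Adj v c) :
    IsStoppingSet Adj (S ∪ T) := by
  refine ⟨?_, fun c hc => ?_⟩
  · rintro v (hv | hv)
    · obtain ⟨c, hc, -⟩ := hS.1 v hv
      exact ⟨c, hc⟩
    · exact hT.1 v hv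
  · by_cases hcT : ∃ v ∈ T, Adj v c
    · obtain ⟨v, hv, w, hw, hvw, hvc, hwc⟩ := hT.2 c hcT
      exact ⟨v, Or.inr hv, w, Or.inr hw, hvw, hvc, hwc⟩
    · have hcD : c ∉ D := fun h => hcT (hD c h)
      obtain ⟨u, hu | hu, huc⟩ := hc
      · obtain ⟨v, hv, w, hw, hvw, hvc, hwc⟩ := hS.2 c ⟨u, hu, huc, hcD⟩
        exact ⟨v, Or.inl hv, w, Or.inl hw, hvw, hvc.1, hwc.1⟩
      · exact absurd ⟨u, hu, huc⟩ hcT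
end

section
/- Let G be a bipartite graph with variable nodes V and check nodes C, and let the resolvable variable nodes be defined inductively as the peeling-decoder fixed point. If S ⊆ V is a stopping set of G and v ∈ S, then v is not resolvable in G. (Membership in a stopping set makes iterative interference-cancellation decoding fail.) -/
/-- The resolvable variable nodes (peeling-decoder fixed point), defined inductively:
`v` is resolvable if there is a check node `c` adjacent to `v` all of whose other
neighbors are resolvable (in particular, if `v` has a singleton slot). -/
inductive Resolvable {V C : Type*} (Adj : V → C → Prop) : V → Prop where
  | intro (v : V) (c : C) (hvc : Adj v c)
      (h : ∀ w : V, Adj w c → w ≠ v → Resolvable Adj w) : Resolvable Adj v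

/-- A variable node belonging to a stopping set is not resolvable by the peeling
decoder. -/
theorem not_resolvable_of_mem_stoppingSet {V C : Type*} [Fintype V] [Fintype C]
    (Adj : V → C → Prop) (S : Set V) (v : V)
    (hS : IsStoppingSet Adj S) (hv : v ∈ S) :
    ¬ Resolvable Adj v := by
  intro hr
  induction hr with
  | intro v c hvc _ ih =>
    obtain ⟨a, ha, b, hb, hab, hac, hbc⟩ := hS.2 c ⟨v, hv, hvc⟩
    by_cases hav : a = v
    · exact ih b hbc (fun hbv => hab (hav.trans hbv.symm)) hb
    · exact ih a hac hav ha
end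

section
/- Let G be a bipartite graph with variable nodes V and check nodes C, and let the resolvable variable nodes be defined inductively as the peeling-decoder fixed point. Then the set W of all variable nodes that are adjacent to at least one check node and are not resolvable is a stopping set of G (possibly empty). -/
/-- The set of all variable nodes that are adjacent to at least one check node and are
not resolvable by the peeling decoder is a (possibly empty) stopping set. -/
theorem unresolved_isStoppingSet {V C : Type*} [Fintype V] [Fintype C]
    (Adj : V → C → Prop) :
    IsStoppingSet Adj {v : V | (∃ c : C, Adj v c) ∧ ¬ Resolvable Adj v} := by
  refine ⟨fun v hv => hv.1, ?_⟩
  rintro c ⟨v, hv, hvc⟩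
  by_contra h
  refine hv.2 (.intro v c hvc fun w hwc hwv => ?_)
  by_contra hw
  exact h ⟨v, hv, w, ⟨⟨c, hwc⟩, hw⟩, hwv.symm, hvc, hwc⟩
end

section
/- Let G be a bipartite graph with variable nodes V and check nodes C, let the resolvable variable nodes be defined inductively as the peeling-decoder fixed point, and let v ∈ V be adjacent to at least one check node. Then v is not resolvable in G if and only if v belongs to some stopping set of G. -/
/-- No element of a stopping set is resolvable. -/
theorem IsStoppingSet.notMem_of_resolvable {V C : Type*} {Adj : V → C → Prop} {S : Set V}
    (hS : IsStoppingSet Adj S) {v : V} (hv : Resolvable Adj v) : v ∉ S := by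
  induction hv with
  | intro v c hvc _ ih =>
    intro hvS
    obtain ⟨a, ha, b, hb, hab, hac, hbc⟩ := hS.2 c ⟨v, hvS, hvc⟩
    by_cases hav : a = v
    · exact ih b hbc (fun hbv => hab (hav.trans hbv.symm)) hb
    · exact ih a hac hav ha

/-- The non-resolvable variable nodes of positive degree form a stopping set. -/
theorem isStoppingSet_setOf_not_resolvable {V C : Type*} (Adj : V → C → Prop) :
    IsStoppingSet Adj {v | ¬ Resolvable Adj v ∧ ∃ c, Adj v c} := by
  refine ⟨fun v hv => hv.2, ?_⟩
  rintro c ⟨v, hv, hvc⟩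
  by_contra! hcon
  refine hv.1 (.intro v c hvc fun w hwc hwv => ?_)
  by_contra hw
  exact hcon v hv w ⟨hw, c, hwc⟩ hwv.symm hvc hwc

/-- A variable node adjacent to at least one check node is not resolvable by the
peeling decoder if and only if it belongs to some stopping set. -/
theorem not_resolvable_iff_mem_stoppingSet {V C : Type*} [Fintype V] [Fintype C]
    (Adj : V → C → Prop) (v : V) (hv : ∃ c : C, Adj v c) :
    ¬ Resolvable Adj v ↔ ∃ S : Set V, IsStoppingSet Adj S ∧ v ∈ S := by
  exact ⟨fun h => ⟨_, isStoppingSet_setOf_not_resolvable Adj, h, hv⟩,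
    fun ⟨_, hS, hvS⟩ h => hS.notMem_of_resolvable h hvS⟩
end

section
/- Graph-theoretic core of Theorem 1: Let G be a bipartite graph with variable nodes V and check nodes C, let D ⊆ C, and let G∖D denote G with the check nodes in D (and their incident edges) deleted. Suppose a variable node v belongs to a stopping set S of G∖D, suppose T ⊆ V is a stopping set of G, and suppose every check node in D is adjacent (in G) to at least one element of T. Then v is not resolvable by the peeling decoder on the full graph G. (Consequently the handshake outcome in which user A declares itself unresolvable on behalf of user B while user B in fact resolves user A, i.e. g = [1, 0, 1], has probability zero.) -/
/-- A set of variable nodes in which every neighboring check node of an element has a further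
neighbor in the set contains no resolvable node. -/
theorem Resolvable.notMem_of_forall_exists_ne {V C : Type*} {Adj : V → C → Prop} {U : Set V}
    (hU : ∀ u ∈ U, ∀ c, Adj u c → ∃ w ∈ U, w ≠ u ∧ Adj w c) {v : V}
    (hv : Resolvable Adj v) : v ∉ U := by
  induction hv with
  | intro v c hvc _ ih =>
    intro hvU
    obtain ⟨w, hwU, hwv, hwc⟩ := hU v hvU c hvc
    exact ih w hwc hwv hwU

/-- A check node adjacent to a stopping set has a neighbor in it other than any given node. -/
theorem IsStoppingSet.exists_adj_ne {V C : Type*} {Adj : V → C → Prop} {S : Set V}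
    (hS : IsStoppingSet Adj S) {c : C} (hc : ∃ u ∈ S, Adj u c) (v : V) :
    ∃ w ∈ S, w ≠ v ∧ Adj w c := by
  obtain ⟨a, ha, b, hb, hab, hac, hbc⟩ := hS.2 c hc
  by_cases hav : a = v
  · exact ⟨b, hb, fun hbv => hab (hav.trans hbv.symm), hbc⟩
  · exact ⟨a, ha, hav, hac⟩

/-- Graph-theoretic core of Theorem 1: if `v` belongs to a stopping set `S` of `G ∖ D`
(the graph with the check nodes in `D` deleted), `T` is a stopping set of the full
graph `G`, and every check node in `D` is adjacent to some element of `T`, then `v` is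
not resolvable by the peeling decoder on the full graph `G`. -/
theorem not_resolvable_of_mem_stoppingSet_of_deleted {V C : Type*} [Fintype V] [Fintype C]
    (Adj : V → C → Prop) (D : Set C) (S T : Set V) (v : V)
    (hS : IsStoppingSet (fun v c => Adj v c ∧ c ∉ D) S) (hv : v ∈ S)
    (hT : IsStoppingSet Adj T)
    (hD : ∀ c ∈ D, ∃ u ∈ T, Adj u c) :
    ¬ Resolvable Adj v := by
  intro hres
  refine hres.notMem_of_forall_exists_ne (U := S ∪ T) ?_ (Or.inl hv)
  intro u hu c huc
  by_cases hcT : ∃ t ∈ T, Adj t c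
  · obtain ⟨w, hwT, hwu, hwc⟩ := hT.exists_adj_ne hcT u
    exact ⟨w, Or.inr hwT, hwu, hwc⟩
  · have huS : u ∈ S := hu.resolve_right fun huT => hcT ⟨u, huT, huc⟩
    have hcD : c ∉ D := fun hc => hcT (hD c hc)
    obtain ⟨w, hwS, hwu, hwc⟩ := hS.exists_adj_ne ⟨u, huS, huc, hcD⟩ u
    exact ⟨w, Or.inl hwS, hwu, hwc.1⟩
end

section
/- Consider the two-user, two-slot unicast toy example: users A and B independently choose their transmission slot sets X_A, X_B ⊆ {1, 2}, where each user chooses {1} with probability 1/4, {2} with probability 1/4, and {1, 2} with probability 1/2 (i.e., degree 1 with probability 1/2, with the slot uniform, and degree 2 with probability 1/2, corresponding to the distribution λ(x) = 0.5x + 0.5x²). The receiver (a degree-0 base station) observes the bipartite graph in which user u is adjacent to slot i iff i ∈ X_u, and decodes by peeling. Then the probability that user A is not resolvable given |X_A| = 1 is 1/4, while the probability that user A is not resolvable given |X_A| = 2 is 1/2; in particular p̄₁ = 1/4 < 1/2 = p̄₂, so the unequal error protection (UEP) property p̄₂ < p̄₁ fails for this frame length. -/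
open MeasureTheory

/-- Two users (`0` = user A, `1` = user B) and two slots: user `u` is adjacent to slot
`i` iff `i` belongs to the slot set the user transmits in (`xa` for A, `xb` for B). -/
def toyAdj (xa xb : Finset (Fin 2)) : Fin 2 → Fin 2 → Prop :=
  fun u i => i ∈ (if u = 0 then xa else xb)

/-- Single-user slot-set distribution of the toy example, corresponding to
`λ(x) = 0.5 x + 0.5 x²`: each slot set `{1}` and `{2}` with probability `1/4`, the set
`{1, 2}` with probability `1/2`. -/
noncomputable def toyDist : Finset (Fin 2) → ENNReal :=
  fun s =>
    if s = {0} then 1/4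
    else if s = {1} then 1/4
    else if s = ({0, 1} : Finset (Fin 2)) then 1/2
    else 0

instance : MeasurableSpace (Finset (Fin 2) × Finset (Fin 2)) := ⊤

/-- The product probability measure of the two users' independent slot-set choices:
an outcome `ω = (X_A, X_B)` has probability `toyDist X_A * toyDist X_B`. -/
noncomputable def toyMeasure : Measure (Finset (Fin 2) × Finset (Fin 2)) :=
  Measure.sum fun p : Finset (Fin 2) × Finset (Fin 2) =>
    (toyDist p.1 * toyDist p.2) • Measure.dirac p

theorem not_resolvable_of_eq (x : Finset (Fin 2)) (v : Fin 2) : ¬ Resolvable (toyAdj x x) v := by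
  intro hv
  induction hv with
  | intro v c hvc _ ih =>
    have hc : c ∈ x := by simpa [toyAdj] using hvc
    exact ih (v + 1) (by simpa [toyAdj] using hc) (by simp)

/-- User A is resolvable iff it transmits at all and the two slot sets differ. -/
theorem resolvable_toyAdj_zero_iff (xa xb : Finset (Fin 2)) :
    Resolvable (toyAdj xa xb) 0 ↔ xa.Nonempty ∧ xa ≠ xb := by
  constructor
  · intro h
    refine ⟨?_, ?_⟩
    · cases h with
      | intro _ c hc _ => exact ⟨c, by simpa [toyAdj] using hc⟩
    · rintro rfl
      exact not_resolvable_of_eq xa 0 h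
  · rintro ⟨⟨c, hc⟩, hne⟩
    by_cases hab : xa ⊆ xb
    · have hba : ¬ xb ⊆ xa := fun h => hne (hab.antisymm h)
      obtain ⟨d, hdb, hda⟩ := Finset.not_subset.mp hba
      have hB : Resolvable (toyAdj xa xb) 1 := by
        refine .intro 1 d (by simpa [toyAdj] using hdb) fun w hw hw1 => ?_
        obtain rfl : w = 0 := by omega
        exact absurd (by simpa [toyAdj] using hw) hda
      refine .intro 0 c (by simpa [toyAdj] using hc) fun w _ hw0 => ?_
      obtain rfl : w = 1 := by omega
      exact hB
    · obtain ⟨d, hda, hdb⟩ := Finset.not_subset.mp hab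
      refine .intro 0 d (by simpa [toyAdj] using hda) fun w hw hw0 => ?_
      obtain rfl : w = 1 := by omega
      exact absurd (by simpa [toyAdj] using hw) hdb

theorem toyMeasure_setOf (p : Finset (Fin 2) × Finset (Fin 2) → Prop) [DecidablePred p] :
    toyMeasure {ω | p ω} =
      ∑ a, ∑ b, if p (a, b) then toyDist a * toyDist b else 0 := by
  rw [toyMeasure, Measure.sum_apply _ MeasurableSpace.measurableSet_top, tsum_fintype, Fintype.sum_prod_type]
  simp [Measure.dirac_apply' _ (show MeasurableSet {ω | p ω} from MeasurableSpace.measurableSet_top), Set.indicator_apply]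

theorem sum_finset_fin_two {M : Type*} [AddCommMonoid M] (f : Finset (Fin 2) → M) :
    ∑ s, f s = f ∅ + f {0} + f {1} + f {0, 1} := by
  rw [show (Finset.univ : Finset (Finset (Fin 2))) = {∅, {0}, {1}, {0, 1}} by decide]
  rw [Finset.sum_insert (by decide), Finset.sum_insert (by decide),
    Finset.sum_insert (by decide), Finset.sum_singleton]
  simp only [add_assoc]

theorem toyDist_empty : toyDist ∅ = 0 := by
  simp [toyDist, show (∅ : Finset (Fin 2)) ≠ {0, 1} by decide,
    show (∅ : Finset (Fin 2)) ≠ {0} by decide, show (∅ : Finset (Fin 2)) ≠ {1} by decide]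

theorem toyDist_zero : toyDist {0} = 1 / 4 := by simp [toyDist]

theorem toyDist_one : toyDist {1} = 1 / 4 := by simp [toyDist]

theorem toyDist_pair : toyDist {0, 1} = 1 / 2 := by
  rw [toyDist, if_neg (by decide), if_neg (by decide), if_pos rfl]

theorem sum_toyDist : ∑ s, toyDist s = 1 := by
  rw [sum_finset_fin_two, toyDist_empty, toyDist_zero, toyDist_one, toyDist_pair,
    ← ENNReal.toReal_eq_one_iff]
  norm_num [ENNReal.toReal_add]

theorem toyMeasure_card_eq (d : ℕ) :
    toyMeasure {ω | ω.1.card = d} = ∑ a, if a.card = d then toyDist a else 0 := by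
  rw [toyMeasure_setOf]
  refine Finset.sum_congr rfl fun a _ => ?_
  by_cases h : a.card = d <;> simp [h, ← Finset.mul_sum, sum_toyDist]

theorem toyMeasure_card_eq_inter_not_resolvable {d : ℕ} (hd : d ≠ 0) :
    toyMeasure ({ω | ω.1.card = d} ∩ {ω | ¬ Resolvable (toyAdj ω.1 ω.2) 0}) =
      ∑ a, if a.card = d then toyDist a * toyDist a else 0 := by
  have hset : {ω : Finset (Fin 2) × Finset (Fin 2) | ω.1.card = d} ∩
      {ω | ¬ Resolvable (toyAdj ω.1 ω.2) 0} = {ω | ω.1.card = d ∧ ω.1 = ω.2} := by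
    ext ⟨a, b⟩
    simp only [Set.mem_inter_iff, Set.mem_ofPred_eq, resolvable_toyAdj_zero_iff, not_and, not_not]
    refine and_congr_right fun h => ⟨fun hr => hr ?_, fun hr _ => hr⟩
    exact Finset.card_ne_zero.mp (h ▸ hd)
  rw [hset, toyMeasure_setOf]
  refine Finset.sum_congr rfl fun a _ => ?_
  by_cases h : a.card = d <;> simp [h]

/-- The two-user, two-slot unicast toy example of Section III-B: the probability that
user A is not resolvable given that A transmits in exactly one slot is `1/4`, while the
probability that user A is not resolvable given that A transmits in exactly two slots
is `1/2`; in particular `p̄₁ = 1/4 < 1/2 = p̄₂`, so the UEP property fails. -/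
theorem toy_uep_fails :
    ProbabilityTheory.cond toyMeasure {ω | ω.1.card = 1}
        {ω | ¬ Resolvable (toyAdj ω.1 ω.2) 0} = 1/4 ∧
    ProbabilityTheory.cond toyMeasure {ω | ω.1.card = 2}
        {ω | ¬ Resolvable (toyAdj ω.1 ω.2) 0} = 1/2 ∧
    (1/4 : ENNReal) < 1/2 := by
  refine ⟨?_, ?_, ?_⟩
  · rw [ProbabilityTheory.cond_apply MeasurableSpace.measurableSet_top, toyMeasure_card_eq,
      toyMeasure_card_eq_inter_not_resolvable one_ne_zero, sum_finset_fin_two, sum_finset_fin_two]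
    simp only [toyDist_empty, toyDist_zero, toyDist_one, toyDist_pair]
    rw [← ENNReal.toReal_eq_toReal_iff' (by norm_num [ENNReal.mul_eq_top]) (by norm_num)]
    norm_num [ENNReal.toReal_add, ENNReal.mul_eq_top]
  · rw [ProbabilityTheory.cond_apply MeasurableSpace.measurableSet_top, toyMeasure_card_eq,
      toyMeasure_card_eq_inter_not_resolvable two_ne_zero, sum_finset_fin_two, sum_finset_fin_two]
    simp only [toyDist_empty, toyDist_zero, toyDist_one, toyDist_pair]
    rw [← ENNReal.toReal_eq_toReal_iff' (by norm_num [ENNReal.mul_eq_top]) (by norm_num)]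
    norm_num [ENNReal.toReal_add, ENNReal.mul_eq_top]
  · rw [← ENNReal.toReal_lt_toReal (by norm_num) (by norm_num)]
    norm_num
end
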